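/- arXiv:2409.12461 — 4 statements merged into one kernel-verified Lean document; each statement's English description precedes it below -/
import Mathlib

section
/- Let G be a game arena, α=(O_p)_{p∈P} an objective profile, S∈{Pos,Σ} a class of strategy profiles, and let T_{G,α,S} be the characterization of common knowledge of rationality for G, α and S. If a player p has a winning strategy in S for her objective O_p, then p wins under every profile t∈T_{G,α,S}, i.e., out(t)∈O_p for all t∈T_{G,α,S}. -/
open scoped Classical

namespace EpistemicRV

/-- Boolean formulas over variables of type `α`. -/
inductive BForm (α : Type) : Type where
  | tru : BForm α
  | fls : BForm α
  | var : α → BForm α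
  | not : BForm α → BForm α
  | and : BForm α → BForm α → BForm α
  | or : BForm α → BForm α → BForm α

/-- Evaluation of a Boolean formula under a truth assignment. -/
def BForm.eval {α : Type} (θ : α → Prop) : BForm α → Prop
  | .tru => True
  | .fls => False
  | .var a => θ a
  | .not f => ¬ (f.eval θ)
  | .and f g => f.eval θ ∧ g.eval θ
  | .or f g => f.eval θ ∨ g.eval θ

/-- Renaming of variables of a Boolean formula. -/
def BForm.map {α β : Type} (h : α → β) : BForm α → BForm β
  | .tru => .tru
  | .fls => .fls
  | .var a => .var (h a)
  | .not f => .not (f.map h)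
  | .and f g => .and (f.map h) (g.map h)
  | .or f g => .or (f.map h) (g.map h)

/-- A game arena: each vertex has an owner, there is an initial vertex and an
edge relation.  (Totality of the edge relation is stated as a separate
hypothesis where needed.) -/
structure Arena (P V : Type) : Type where
  owner : V → P
  v0 : V
  edge : V → V → Prop

/-- A strategy: given the (reversed) past history and the current vertex,
it yields the next vertex.  A history `h v` (ending in the current vertex `v`)
is represented by the pair of the reversed list `h` and `v`. -/
abbrev Strat (V : Type) : Type := List V → V → V

/-- A strategy profile assigns a strategy to every player. -/
abbrev Profile (P V : Type) : Type := P → Strat V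

variable {P V : Type}

/-- A strategy respecting the edge relation. -/
def ValidStrat (A : Arena P V) (s : Strat V) : Prop := ∀ h v, A.edge v (s h v)

/-- A positional strategy only depends on the current vertex. -/
def PositionalStrat (s : Strat V) : Prop := ∀ h h' v, s h v = s h' v

/-- The class Σ of all strategies. -/
def allClass (A : Arena P V) : Set (Strat V) := {s | ValidStrat A s}

/-- The class Pos of positional strategies. -/
def posClass (A : Arena P V) : Set (Strat V) := {s | ValidStrat A s ∧ PositionalStrat s}

/-- Strategy profiles ranging over the class `C` of strategies. -/
def profiles (A : Arena P V) (C : Set (Strat V)) : Set (Profile P V) :=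
  {s | ∀ p, s p ∈ C}

/-- `upd s p t` is the profile `s[p ↦ t]`. -/
noncomputable def upd (s : Profile P V) (p : P) (t : Strat V) : Profile P V :=
  fun q => if q = p then t else s q

/-- The reversed history of length `n+1` generated by the profile `s`. -/
def histOf (A : Arena P V) (s : Profile P V) : ℕ → List V
  | 0 => [A.v0]
  | n + 1 =>
    match histOf A s n with
    | [] => [A.v0]
    | v :: h => s (A.owner v) h v :: v :: h

/-- The outcome play `out(s)` of the profile `s`. -/
def Out (A : Arena P V) (s : Profile P V) : ℕ → V :=
  fun n => (histOf A s n).getD 0 A.v0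

/-- The set of plays of an arena. -/
def plays (A : Arena P V) : Set (ℕ → V) :=
  {ρ | ρ 0 = A.v0 ∧ ∀ i, A.edge (ρ i) (ρ (i + 1))}

/-- `Inf(ρ)`: the set of vertices occurring infinitely often in `ρ`. -/
def InfSet (ρ : ℕ → V) : Set V := {v | ∀ i, ∃ j, i ≤ j ∧ ρ j = v}

/-- The Büchi objective for the set `U` of vertices. -/
def Buchi (U : Set V) : Set (ℕ → V) := {ρ | (InfSet ρ ∩ U).Nonempty}

/-- The Muller objective for a Boolean formula over the vertices. -/
def Muller (φ : BForm V) : Set (ℕ → V) := {ρ | φ.eval (fun v => v ∈ InfSet ρ)}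

/-- `s` is a Nash equilibrium for the objective profile `O` and the class `C`. -/
def NashEq (A : Arena P V) (O : P → Set (ℕ → V)) (C : Set (Strat V))
    (s : Profile P V) : Prop :=
  ∀ p, ∀ t ∈ C, Out A (upd s p t) ∈ O p → Out A s ∈ O p

/-- `t` is a winning strategy of player `p` for objective `Op` over class `C`. -/
def WinningStrat (A : Arena P V) (Op : Set (ℕ → V)) (C : Set (Strat V))
    (p : P) (t : Strat V) : Prop :=
  t ∈ C ∧ ∀ s ∈ profiles A C, Out A (upd s p t) ∈ Op

/-- Knowledge operator of a single accessibility relation. -/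
def Kop {W : Type} (R : W → W → Prop) (E : Set W) : Set W :=
  {w | ∀ w', R w w' → w' ∈ E}

/-- Mutual knowledge operator. -/
def MKop {W : Type} (R : P → W → W → Prop) (E : Set W) : Set W :=
  ⋂ p, Kop (R p) E

/-- Common knowledge operator: `CK(E) = ⋂_{i ≥ 1} MK^i(E)`. -/
def CKop {W : Type} (R : P → W → W → Prop) (E : Set W) : Set W :=
  ⋂ i ∈ Set.Ici (1 : ℕ), (MKop R)^[i] E

/-- Player `p` is rational in world `w` (for arena `A`, objective profile `O`,
class `C`, accessibility relations `R` and strategy assignment `σ`). -/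
def RationalIn (A : Arena P V) (O : P → Set (ℕ → V)) (C : Set (Strat V))
    {W : Type} (R : P → W → W → Prop) (σ : W → Profile P V) (p : P) (w : W) : Prop :=
  ¬ ∃ t ∈ C,
      (∀ w', R p w w' → (Out A (σ w') ∈ O p → Out A (upd (σ w') p t) ∈ O p)) ∧
      (∃ w', R p w w' ∧ Out A (σ w') ∉ O p ∧ Out A (upd (σ w') p t) ∈ O p)

/-- The set of worlds in which every player is rational. -/
def RAT (A : Arena P V) (O : P → Set (ℕ → V)) (C : Set (Strat V))
    {W : Type} (R : P → W → W → Prop) (σ : W → Profile P V) : Set W :=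
  {w | ∀ p, RationalIn A O C R σ p w}

/-- An epistemic model for the arena `A` and the class `C` of strategies. -/
structure EModel {P V : Type} (A : Arena P V) (C : Set (Strat V)) : Type 1 where
  W : Type
  finW : Finite W
  R : P → W → W → Prop
  equivR : ∀ p, Equivalence (R p)
  σ : W → Profile P V
  memC : ∀ w, σ w ∈ profiles A C
  consistent : ∀ p w w', R p w w' → σ w p = σ w' p

/-- The characterization `T_{G,α,S}` of common knowledge of rationality. -/
def Tchar (A : Arena P V) (O : P → Set (ℕ → V)) (C : Set (Strat V)) :
    Set (Profile P V) :=
  {s | ∃ M : EModel A C, ∃ w : M.W,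
        w ∈ CKop M.R (RAT A O C M.R M.σ) ∧ M.σ w = s}

end EpistemicRV

namespace EpistemicRV

/-- if a player `p` has a winning strategy in `S ∈ {Pos, Σ}` for
her objective, then `p` wins under every profile in `T_{G,α,S}`. -/
theorem winning_strategy_wins_on_Tchar {P V : Type} [Fintype P] [Fintype V]
    (A : Arena P V) (htotal : ∀ v, ∃ u, A.edge v u)
    (O : P → Set (ℕ → V)) (C : Set (Strat V))
    (hC : C = posClass A ∨ C = allClass A)
    (p : P) (t : Strat V) (ht : WinningStrat A (O p) C p t) :
    ∀ s ∈ Tchar A O C, Out A s ∈ O p := by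
  rintro _ ⟨M, w, hw, rfl⟩
  have hmk : w ∈ MKop M.R (RAT A O C M.R M.σ) :=
    Set.mem_iInter₂.mp hw 1 (Set.mem_Ici.mpr le_rfl)
  have hrat : w ∈ RAT A O C M.R M.σ :=
    Set.mem_iInter.mp hmk p w ((M.equivR p).refl w)
  by_contra hlose
  exact hrat p ⟨t, ht.1, fun w' _ _ => ht.2 _ (M.memC w'),
    w, (M.equivR p).refl w, hlose, ht.2 _ (M.memC w)⟩

end EpistemicRV
end

section
/- Let G be a game arena, α=(O_p)_{p∈P} an objective profile, and S∈{Pos,Σ}. Let s∈S be a Nash equilibrium for α and S, and let M be the epistemic model with a single world w, R_p={(w,w)} for every p, and σ(w)=s. Then w ∈ CK(RAT_{G,α,M,S}); i.e., in this one-world model, rationality of all players is common knowledge at w. -/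
open scoped Classical

namespace EpistemicRV

theorem MKop_univ {P W : Type} (R : P → W → W → Prop) :
    MKop R Set.univ = Set.univ := by
  simp [MKop, Kop]

theorem CKop_univ {P W : Type} (R : P → W → W → Prop) :
    CKop R Set.univ = Set.univ := by
  simp [CKop, Function.iterate_fixed (MKop_univ R)]

/-- In a model where every world carries the same Nash equilibrium, all players are
rational everywhere. -/
theorem NashEq.RAT_const_eq_univ {P V W : Type} {A : Arena P V} {O : P → Set (ℕ → V)}
    {C : Set (Strat V)} {s : Profile P V} (hs : NashEq A O C s) (R : P → W → W → Prop) :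
    RAT A O C R (fun _ => s) = Set.univ := by
  refine Set.eq_univ_of_forall fun w p => ?_
  rintro ⟨t, ht, -, w', -, hlose, hwin⟩
  exact hlose (hs p t ht hwin)

/-- for a Nash equilibrium `s`, in the one-world epistemic model
(world `PUnit.unit`, `R_p = {(w,w)}`, `σ(w) = s`) rationality of all players is
common knowledge at the unique world. -/
theorem nash_singleton_model_CKR {P V : Type} [Fintype P] [Fintype V]
    (A : Arena P V) (htotal : ∀ v, ∃ u, A.edge v u)
    (O : P → Set (ℕ → V)) (C : Set (Strat V))
    (hC : C = posClass A ∨ C = allClass A)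
    (s : Profile P V) (hs : s ∈ profiles A C) (hnash : NashEq A O C s) :
    (PUnit.unit : PUnit) ∈
      CKop (fun (_ : P) (_ _ : PUnit) => True)
        (RAT A O C (fun (_ : P) (_ _ : PUnit) => True) (fun _ => s)) := by
  rw [hnash.RAT_const_eq_univ, CKop_univ]
  exact Set.mem_univ _

end EpistemicRV
end

section
/- Let ψ be a Boolean formula over variables x_1,…,x_n,y_1,…,y_m and let G_ψ be the two-player cycle arena constructed from ψ, with players A and E. For every profile s of positional strategies and every Boolean formula φ over the variables x_1,…,x_n,y_1,…,y_m (read as a Muller objective whose vertex-variables are the literal vertices), the outcome play out(s) belongs to Muller(φ) if and only if φ is true under the truth assignment θ_s corresponding to s; in particular, the chosen literal vertices occur infinitely often in out(s) and the unchosen literal vertices never occur. -/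
open scoped Classical

namespace EpistemicRV

/-- Vertices of the two-player cycle arena `G_ψ`: choice vertices `a i` and
literal vertices `x i b` of player `A`, and choice vertices `e j` and literal
vertices `y j b` of player `E` (`b = true` is the positive literal). -/
inductive CycleV (n m : ℕ) : Type where
  | a : Fin n → CycleV n m
  | x : Fin n → Bool → CycleV n m
  | e : Fin m → CycleV n m
  | y : Fin m → Bool → CycleV n m

/-- Edges of the cycle arena:
`a_i → x_i, x̄_i`, `x_i, x̄_i → a_{i+1}` (or `→ e_1` when `i = n`),
`e_j → y_j, ȳ_j`, `y_j, ȳ_j → e_{j+1}` (or `→ a_1` when `j = m`). -/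
def cycleEdge {n m : ℕ} : CycleV n m → CycleV n m → Prop
  | .a i, .x i' _ => i = i'
  | .x i _, .a i' => (i : ℕ) + 1 = (i' : ℕ)
  | .x i _, .e j => (i : ℕ) + 1 = n ∧ (j : ℕ) = 0
  | .e j, .y j' _ => j = j'
  | .y j _, .e j' => (j : ℕ) + 1 = (j' : ℕ)
  | .y j _, .a i' => (j : ℕ) + 1 = m ∧ (i' : ℕ) = 0
  | _, _ => False

/-- The two-player cycle arena: the player `false` is `A` and owns the `a`/`x`
vertices, the player `true` is `E` and owns the `e`/`y` vertices; the initial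
vertex is `a_1`. -/
def cycleArena (n m : ℕ) (hn : 0 < n) : Arena Bool (CycleV n m) where
  owner := fun v =>
    match v with
    | .a _ => false
    | .x _ _ => false
    | .e _ => true
    | .y _ _ => true
  v0 := .a ⟨0, hn⟩
  edge := cycleEdge

/-- The positive literal vertex corresponding to a variable
(`x_i` on the left, `y_j` on the right). -/
def litVertex {n m : ℕ} : Fin n ⊕ Fin m → CycleV n m :=
  Sum.elim (fun i => .x i true) (fun j => .y j true)

/-- The truth assignment `θ_s` corresponding to a positional profile `s`:
a variable is true iff its positive literal vertex is chosen. -/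
def thetaOf {n m : ℕ} (s : Profile Bool (CycleV n m)) : Fin n ⊕ Fin m → Prop
  | .inl i => s false [] (.a i) = CycleV.x i true
  | .inr j => s true [] (.e j) = CycleV.y j true

end EpistemicRV

namespace EpistemicRV

theorem BForm.eval_map {α β : Type} (h : α → β) (θ : β → Prop) (φ : BForm α) :
    (φ.map h).eval θ ↔ φ.eval (θ ∘ h) := by
  induction φ <;> simp_all [BForm.map, BForm.eval]

theorem histOf_ne_nil {P V : Type} (A : Arena P V) (s : Profile P V) (k : ℕ) :
    histOf A s k ≠ [] := by
  cases k with
  | zero => simp [histOf]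
  | succ k =>
    rw [histOf]
    split <;> simp

theorem Out_succ {P V : Type} {A : Arena P V} {s : Profile P V}
    (hs : ∀ p, PositionalStrat (s p)) (k : ℕ) :
    Out A s (k + 1) = s (A.owner (Out A s k)) [] (Out A s k) := by
  rcases h : histOf A s k with _ | ⟨v, l⟩
  · exact absurd h (histOf_ne_nil A s k)
  · simpa [Out, histOf, h] using hs (A.owner v) l [] v

theorem edge_Out {P V : Type} {A : Arena P V} {s : Profile P V}
    (hs : s ∈ profiles A (posClass A)) (k : ℕ) :
    A.edge (Out A s k) (Out A s (k + 1)) := by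
  rw [Out_succ fun p => (hs p).2]
  exact (hs _).1 _ _

theorem mem_InfSet_Out_succ {P V : Type} {A : Arena P V} {s : Profile P V}
    (hs : ∀ p, PositionalStrat (s p)) {v : V} (hv : v ∈ InfSet (Out A s)) :
    s (A.owner v) [] v ∈ InfSet (Out A s) := by
  intro k
  obtain ⟨t, hkt, ht⟩ := hv k
  exact ⟨t + 1, by omega, by rw [Out_succ hs, ht]⟩

section CycleArena

variable {n m : ℕ} {ρ : ℕ → CycleV n m}

theorem cycleEdge_a {i : Fin n} {v : CycleV n m} (h : cycleEdge (.a i) v) :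
    ∃ b, v = .x i b := by
  cases v <;> simp_all [cycleEdge]

theorem cycleEdge_e {j : Fin m} {v : CycleV n m} (h : cycleEdge (.e j) v) :
    ∃ b, v = .y j b := by
  cases v <;> simp_all [cycleEdge]

theorem cycleEdge_to_x {i : Fin n} {b : Bool} {v : CycleV n m}
    (h : cycleEdge v (.x i b)) : v = .a i := by
  cases v <;> simp_all [cycleEdge]

theorem cycleEdge_to_y {j : Fin m} {b : Bool} {v : CycleV n m}
    (h : cycleEdge v (.y j b)) : v = .e j := by
  cases v <;> simp_all [cycleEdge]

theorem cycleEdge_x_of_lt {i : Fin n} {b : Bool} {v : CycleV n m}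
    (h : cycleEdge (.x i b) v) (hi : (i : ℕ) + 1 < n) : v = .a ⟨i + 1, hi⟩ := by
  cases v with
  | a i' => exact congrArg _ (Fin.ext h.symm)
  | e j => exact absurd h.1 hi.ne
  | x | y => exact h.elim

theorem cycleEdge_x_last (hm : 0 < m) {i : Fin n} {b : Bool} {v : CycleV n m}
    (h : cycleEdge (.x i b) v) (hi : (i : ℕ) + 1 = n) : v = .e ⟨0, hm⟩ := by
  cases v with
  | a i' => exact absurd (h.symm.trans hi) i'.isLt.ne
  | e j => exact congrArg _ (Fin.ext h.2)
  | x | y => exact h.elim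

theorem cycleEdge_y_of_lt {j : Fin m} {b : Bool} {v : CycleV n m}
    (h : cycleEdge (.y j b) v) (hj : (j : ℕ) + 1 < m) : v = .e ⟨j + 1, hj⟩ := by
  cases v with
  | e j' => exact congrArg _ (Fin.ext h.symm)
  | a i => exact absurd h.1 hj.ne
  | x | y => exact h.elim

theorem cycleEdge_y_last (hn : 0 < n) {j : Fin m} {b : Bool} {v : CycleV n m}
    (h : cycleEdge (.y j b) v) (hj : (j : ℕ) + 1 = m) : v = .a ⟨0, hn⟩ := by
  cases v with
  | e j' => exact absurd (h.symm.trans hj) j'.isLt.ne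
  | a i => exact congrArg _ (Fin.ext h.2)
  | x | y => exact h.elim

theorem play_eq_a (hρ : ∀ k, cycleEdge (ρ k) (ρ (k + 1))) (hn : 0 < n) {t : ℕ}
    (ht : ρ t = .a ⟨0, hn⟩) (i : ℕ) (hi : i < n) : ρ (t + 2 * i) = .a ⟨i, hi⟩ := by
  induction i with
  | zero => exact ht
  | succ i ih =>
    have ha := hρ (t + 2 * i)
    rw [ih (by omega)] at ha
    obtain ⟨b, hb⟩ := cycleEdge_a ha
    have hx := hρ (t + 2 * i + 1)
    rw [hb] at hx
    exact cycleEdge_x_of_lt hx hi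

theorem play_eq_e (hρ : ∀ k, cycleEdge (ρ k) (ρ (k + 1))) (hn : 0 < n) {t : ℕ}
    (ht : ρ t = .a ⟨0, hn⟩) (j : ℕ) (hj : j < m) :
    ρ (t + 2 * n + 2 * j) = .e ⟨j, hj⟩ := by
  induction j with
  | zero =>
    have ha := hρ (t + 2 * (n - 1))
    rw [play_eq_a hρ hn ht (n - 1) (by omega)] at ha
    obtain ⟨b, hb⟩ := cycleEdge_a ha
    have hx := hρ (t + 2 * (n - 1) + 1)
    rw [hb] at hx
    have he := cycleEdge_x_last hj hx (Nat.sub_add_cancel hn)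
    rwa [show t + 2 * (n - 1) + 1 + 1 = t + 2 * n + 2 * 0 by omega] at he
  | succ j ih =>
    have he := hρ (t + 2 * n + 2 * j)
    rw [ih (by omega)] at he
    obtain ⟨b, hb⟩ := cycleEdge_e he
    have hy := hρ (t + 2 * n + 2 * j + 1)
    rw [hb] at hy
    exact cycleEdge_y_of_lt hy hj

theorem play_period (hρ : ∀ k, cycleEdge (ρ k) (ρ (k + 1))) (hn : 0 < n) (hm : 0 < m)
    {t : ℕ} (ht : ρ t = .a ⟨0, hn⟩) : ρ (t + 2 * (n + m)) = .a ⟨0, hn⟩ := by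
  have he := hρ (t + 2 * n + 2 * (m - 1))
  rw [play_eq_e hρ hn ht (m - 1) (by omega)] at he
  obtain ⟨b, hb⟩ := cycleEdge_e he
  have hy := hρ (t + 2 * n + 2 * (m - 1) + 1)
  rw [hb] at hy
  have ha := cycleEdge_y_last hn hy (Nat.sub_add_cancel hm)
  rwa [show t + 2 * n + 2 * (m - 1) + 1 + 1 = t + 2 * (n + m) by omega] at ha

theorem a_zero_mem_InfSet (hρ : ∀ k, cycleEdge (ρ k) (ρ (k + 1))) (hn : 0 < n)
    (hm : 0 < m) (h0 : ρ 0 = .a ⟨0, hn⟩) : .a ⟨0, hn⟩ ∈ InfSet ρ := by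
  intro k
  induction k with
  | zero => exact ⟨0, le_rfl, h0⟩
  | succ k ih =>
    obtain ⟨t, hkt, ht⟩ := ih
    exact ⟨_, by omega, play_period hρ hn hm ht⟩

theorem a_mem_InfSet (hρ : ∀ k, cycleEdge (ρ k) (ρ (k + 1))) (hn : 0 < n)
    (hm : 0 < m) (h0 : ρ 0 = .a ⟨0, hn⟩) (i : Fin n) : .a i ∈ InfSet ρ := by
  intro k
  obtain ⟨t, hkt, ht⟩ := a_zero_mem_InfSet hρ hn hm h0 k
  exact ⟨_, by omega, play_eq_a hρ hn ht i i.isLt⟩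

theorem e_mem_InfSet (hρ : ∀ k, cycleEdge (ρ k) (ρ (k + 1))) (hn : 0 < n)
    (hm : 0 < m) (h0 : ρ 0 = .a ⟨0, hn⟩) (j : Fin m) : .e j ∈ InfSet ρ := by
  intro k
  obtain ⟨t, hkt, ht⟩ := a_zero_mem_InfSet hρ hn hm h0 k
  exact ⟨_, by omega, play_eq_e hρ hn ht j j.isLt⟩

variable {hn : 0 < n} {s : Profile Bool (CycleV n m)}

theorem chosen_of_Out_eq_x
    (hs : s ∈ profiles (cycleArena n m hn) (posClass (cycleArena n m hn)))
    {i : Fin n} {b : Bool} {k : ℕ} (hk : Out (cycleArena n m hn) s k = .x i b) :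
    s false [] (.a i) = .x i b := by
  cases k with
  | zero => cases hk
  | succ k =>
    have he := edge_Out hs k
    rw [hk] at he
    have ha := cycleEdge_to_x he
    rwa [Out_succ fun p => (hs p).2, ha] at hk

theorem chosen_of_Out_eq_y
    (hs : s ∈ profiles (cycleArena n m hn) (posClass (cycleArena n m hn)))
    {j : Fin m} {b : Bool} {k : ℕ} (hk : Out (cycleArena n m hn) s k = .y j b) :
    s true [] (.e j) = .y j b := by
  cases k with
  | zero => cases hk
  | succ k =>
    have he := edge_Out hs k
    rw [hk] at he
    have ha := cycleEdge_to_y he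
    rwa [Out_succ fun p => (hs p).2, ha] at hk

theorem x_mem_InfSet_iff (hm : 0 < m)
    (hs : s ∈ profiles (cycleArena n m hn) (posClass (cycleArena n m hn)))
    (i : Fin n) (b : Bool) :
    .x i b ∈ InfSet (Out (cycleArena n m hn) s) ↔ s false [] (.a i) = .x i b := by
  refine ⟨fun h => ?_, fun h => ?_⟩
  · obtain ⟨k, -, hk⟩ := h 0
    exact chosen_of_Out_eq_x hs hk
  · rw [← h]
    exact mem_InfSet_Out_succ (fun p => (hs p).2)
      (a_mem_InfSet (edge_Out hs) hn hm rfl i)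

theorem y_mem_InfSet_iff (hm : 0 < m)
    (hs : s ∈ profiles (cycleArena n m hn) (posClass (cycleArena n m hn)))
    (j : Fin m) (b : Bool) :
    .y j b ∈ InfSet (Out (cycleArena n m hn) s) ↔ s true [] (.e j) = .y j b := by
  refine ⟨fun h => ?_, fun h => ?_⟩
  · obtain ⟨k, -, hk⟩ := h 0
    exact chosen_of_Out_eq_y hs hk
  · rw [← h]
    exact mem_InfSet_Out_succ (fun p => (hs p).2)
      (e_mem_InfSet (edge_Out hs) hn hm rfl j)

end CycleArena

/-- for every positional profile `s` in the cycle arena and every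
Boolean formula `φ` over the variables (read as a Muller objective via the
positive literal vertices), `out(s) ∈ Muller(φ)` iff `φ` is true under `θ_s`;
in particular, a literal vertex occurs infinitely often in `out(s)` iff it is
chosen, and an unchosen literal vertex never occurs. -/
theorem cycle_muller_iff_eval (n m : ℕ) (hn : 0 < n) (hm : 0 < m)
    (s : Profile Bool (CycleV n m))
    (hs : s ∈ profiles (cycleArena n m hn) (posClass (cycleArena n m hn))) :
    (∀ φ : BForm (Fin n ⊕ Fin m),
        Out (cycleArena n m hn) s ∈ Muller (φ.map litVertex) ↔
          φ.eval (thetaOf s)) ∧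
    (∀ (i : Fin n) (b : Bool),
        (CycleV.x i b ∈ InfSet (Out (cycleArena n m hn) s) ↔
          s false [] (CycleV.a i) = CycleV.x i b) ∧
        (s false [] (CycleV.a i) ≠ CycleV.x i b →
          ∀ k, Out (cycleArena n m hn) s k ≠ CycleV.x i b)) ∧
    (∀ (j : Fin m) (b : Bool),
        (CycleV.y j b ∈ InfSet (Out (cycleArena n m hn) s) ↔
          s true [] (CycleV.e j) = CycleV.y j b) ∧
        (s true [] (CycleV.e j) ≠ CycleV.y j b →
          ∀ k, Out (cycleArena n m hn) s k ≠ CycleV.y j b)) := by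
  refine ⟨fun φ => ?_,
    fun i b => ⟨x_mem_InfSet_iff hm hs i b, fun h k hk => h (chosen_of_Out_eq_x hs hk)⟩,
    fun j b => ⟨y_mem_InfSet_iff hm hs j b, fun h k hk => h (chosen_of_Out_eq_y hs hk)⟩⟩
  have hθ : (fun v => v ∈ InfSet (Out (cycleArena n m hn) s)) ∘ litVertex = thetaOf s := by
    funext c
    cases c with
    | inl i => exact propext (x_mem_InfSet_iff hm hs i true)
    | inr j => exact propext (y_mem_InfSet_iff hm hs j true)
  rw [← hθ]
  exact BForm.eval_map _ _ φ

end EpistemicRV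
end

section
/- Let G be a game arena, α=(O_p)_{p∈P} an objective profile, and Pos the (finite) set of positional strategy profiles. For a subset T⊆Pos, define the epistemic model M(T)=(T,(R_p)_{p∈P},σ) where the worlds are the profiles in T, σ is the identity map, and (s,s')∈R_p iff s_p=s'_p. Then a positional profile t belongs to T_{G,α,Pos} if and only if there exists a subset T⊆Pos with t∈T such that, regarded as a world of M(T), t∈CK(RAT_{G,α,M(T),Pos}). -/
open scoped Classical

namespace EpistemicRV

theorem CKop_subset {P W : Type} [Nonempty P] {R : P → W → W → Prop}
    (hR : ∀ p w, R p w w) (E : Set W) : CKop R E ⊆ E := by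
  intro w hw
  obtain ⟨p⟩ := ‹Nonempty P›
  have h : w ∈ MKop R E := Set.mem_iInter₂.1 hw 1 Set.self_mem_Ici
  exact Set.mem_iInter.1 h p w (hR p w)

theorem CKop_closed {P W : Type} {R : P → W → W → Prop} {E : Set W} {p : P} {w w' : W}
    (hw : w ∈ CKop R E) (h : R p w w') : w' ∈ CKop R E := by
  refine Set.mem_iInter₂.2 fun i _ => ?_
  have hi := Set.mem_iInter₂.1 hw (i + 1) (Set.mem_Ici.2 (Nat.le_add_left 1 i))
  rw [Function.iterate_succ_apply'] at hi
  exact Set.mem_iInter.1 hi p w' h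

/-- In the model on the image of the worlds with common knowledge of rationality,
every player is rational everywhere. -/
theorem RAT_image_CKop_eq_univ {P V : Type} {A : Arena P V} {O : P → Set (ℕ → V)}
    {C : Set (Strat V)} (M : EModel A C) :
    RAT A O C (fun p (w w' : ↥(M.σ '' CKop M.R (RAT A O C M.R M.σ))) => w.1 p = w'.1 p)
      Subtype.val = Set.univ := by
  have : Nonempty P := ⟨A.owner A.v0⟩
  refine Set.eq_univ_of_forall ?_
  rintro s p ⟨t, ht, hdom, ⟨_, w', hw', rfl⟩, hs, hlose, hwin⟩
  refine CKop_subset (fun p => (M.equivR p).refl) _ hw' p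
    ⟨t, ht, fun w'' hR => ?_, w', (M.equivR p).refl w', hlose, hwin⟩
  exact hdom ⟨M.σ w'', w'', CKop_closed hw' hR, rfl⟩ (hs.trans (M.consistent p w' w'' hR))

/-- a positional profile `t` belongs to `T_{G,α,Pos}` iff there
is a (finite) subset `T` of the positional profiles containing `t` such that,
in the epistemic model `M(T)` whose worlds are the members of `T`, with
`σ` the identity and `(s,s') ∈ R_p ↔ s_p = s'_p`, the world `t` satisfies
`t ∈ CK(RAT)`. -/
theorem Tchar_iff_subset_model {P V : Type} [Fintype P] [Fintype V]
    (A : Arena P V) (htotal : ∀ v, ∃ u, A.edge v u)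
    (O : P → Set (ℕ → V)) (t : Profile P V) :
    t ∈ Tchar A O (posClass A) ↔
      ∃ T : Set (Profile P V), T ⊆ profiles A (posClass A) ∧ T.Finite ∧
        ∃ ht : t ∈ T,
          (⟨t, ht⟩ : ↥T) ∈
            CKop (fun p (w w' : ↥T) => w.1 p = w'.1 p)
              (RAT A O (posClass A)
                (fun p (w w' : ↥T) => w.1 p = w'.1 p) Subtype.val) := by
  constructor
  · rintro ⟨M, w, hw, rfl⟩
    have := M.finW
    refine ⟨M.σ '' CKop M.R (RAT A O (posClass A) M.R M.σ), ?_, Set.toFinite _,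
      ⟨w, hw, rfl⟩, ?_⟩
    · rintro _ ⟨w', -, rfl⟩
      exact M.memC w'
    · rw [RAT_image_CKop_eq_univ, CKop_univ]
      trivial
  · rintro ⟨T, hT, hfin, ht, h⟩
    exact ⟨⟨T, hfin.to_subtype, fun p w w' => w.1 p = w'.1 p,
      fun p => ⟨fun _ => rfl, Eq.symm, Eq.trans⟩, Subtype.val, fun w => hT w.2,
      fun _ _ _ h => h⟩, ⟨t, ht⟩, h, rfl⟩

end EpistemicRV
end
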